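/- Let T be an (α,β)-RK operator on a complex Banach space X with 0 ≤ α < 1 and β ≥ 1. Then ‖T^n‖ = O(n^β), i.e. there exists a constant M > 0 such that ‖T^n‖ ≤ M n^β for all n ∈ ℕ. -/

import Mathlib

/-- A bounded linear operator `T` on a complex Banach space is `(α,β)`-RK with constant `C` if
`C ≥ 1` and for every `λ ∈ ℂ` with `|λ| > 1` the operator `λI − T` is invertible with
`‖(λI − T)⁻¹‖ ≤ C |λ|^(α+β−1) / (|λ−1|^α (|λ|−1)^β)`. -/
def IsRK {X : Type*} [NormedAddCommGroup X] [NormedSpace ℂ X]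
    (T : X →L[ℂ] X) (α β C : ℝ) : Prop :=
  1 ≤ C ∧ ∀ lam : ℂ, 1 < ‖lam‖ →
    IsUnit (algebraMap ℂ (X →L[ℂ] X) lam - T) ∧
    ‖Ring.inverse (algebraMap ℂ (X →L[ℂ] X) lam - T)‖ ≤
      C * ‖lam‖ ^ (α + β - 1) / (‖lam - 1‖ ^ α * (‖lam‖ - 1) ^ β)

open MeasureTheory Set Metric in
/-- Cauchy's estimate for the powers of an element of a complex Banach algebra, in terms of the
`L¹` norm of the resolvent on a circle. -/
theorem norm_pow_le_integral_norm_inverse_one_sub_smul {A : Type*} [NormedRing A]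
    [NormedAlgebra ℂ A] [CompleteSpace A] (a : A) {R : ℝ} (hR : 0 < R)
    (ha : ∀ z : ℂ, ‖z‖ ≤ R → IsUnit (1 - z • a)) (n : ℕ) :
    ‖a ^ n‖ ≤ ((2 * Real.pi)⁻¹ *
      ∫ θ in (0 : ℝ)..2 * Real.pi, ‖Ring.inverse (1 - circleMap 0 R θ • a)‖) * R⁻¹ ^ n := by
  lift R to NNReal using hR.le
  have hd : DifferentiableOn ℂ (fun z : ℂ => Ring.inverse (1 - z • a)) (closedBall 0 R) := by
    intro z hz
    have hd₁ : Differentiable ℂ fun w : ℂ => 1 - w • a :=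
      (differentiable_id.smul_const a).const_sub 1
    exact (DifferentiableAt.comp z
      (differentiableAt_inverse (ha z (mem_closedBall_zero_iff.mp hz)))
      hd₁.differentiableAt).differentiableWithinAt
  have heq := (spectrum.hasFPowerSeriesOnBall_inverse_one_sub_smul ℂ
    a).hasFPowerSeriesAt.eq_formalMultilinearSeries
      (hd.hasFPowerSeriesOnBall (by exact_mod_cast hR)).hasFPowerSeriesAt
  have hn := congrArg norm (congrFun heq n)
  rw [ContinuousMultilinearMap.norm_mkPiRing] at hn
  rw [hn]
  simpa using norm_cauchyPowerSeries_le (fun z : ℂ => Ring.inverse (1 - z • a)) 0 R n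

theorem one_sub_inv_smul_eq {A : Type*} [Ring A] [Algebra ℂ A] (a : A) {z : ℂ} (hz : z ≠ 0) :
    1 - z⁻¹ • a = z⁻¹ • (algebraMap ℂ A z - a) := by
  rw [smul_sub, Algebra.algebraMap_eq_smul_one, inv_smul_smul₀ hz]

theorem isUnit_one_sub_inv_smul {A : Type*} [Ring A] [Algebra ℂ A] {a : A} {z : ℂ} (hz : z ≠ 0)
    (h : IsUnit (algebraMap ℂ A z - a)) : IsUnit (1 - z⁻¹ • a) := by
  rw [one_sub_inv_smul_eq a hz]
  exact h.smul (Units.mk0 z⁻¹ (inv_ne_zero hz))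

theorem inverse_one_sub_inv_smul {A : Type*} [Ring A] [Algebra ℂ A] {a : A} {z : ℂ} (hz : z ≠ 0)
    (h : IsUnit (algebraMap ℂ A z - a)) :
    Ring.inverse (1 - z⁻¹ • a) = z • Ring.inverse (algebraMap ℂ A z - a) := by
  have hu := isUnit_one_sub_inv_smul hz h
  have hmul : (1 - z⁻¹ • a) * (z • Ring.inverse (algebraMap ℂ A z - a)) = 1 := by
    rw [one_sub_inv_smul_eq a hz, smul_mul_smul_comm, inv_mul_cancel₀ hz,
      Ring.mul_inverse_cancel _ h, one_smul]
  exact left_inv_eq_right_inv (Ring.inverse_mul_cancel _ hu) hmul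

theorem two_mul_sin_half_le_norm_circleMap_sub_one {r : ℝ} (hr : 1 ≤ r) (θ : ℝ) :
    2 * Real.sin (θ / 2) ≤ ‖circleMap 0 r θ - 1‖ := by
  apply Real.le_sqrt_of_sq_le
  have hre : (circleMap 0 r θ - 1).re = r * Real.cos θ - 1 := by
    simp [circleMap, Complex.exp_ofReal_mul_I_re]
  have him : (circleMap 0 r θ - 1).im = r * Real.sin θ := by
    simp [circleMap, Complex.exp_ofReal_mul_I_im]
  rw [Complex.normSq_apply, hre, him]
  have hcos : Real.cos θ = 1 - 2 * Real.sin (θ / 2) ^ 2 := by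
    have h := Real.cos_two_mul (θ / 2)
    rw [mul_div_cancel₀ θ two_ne_zero] at h
    linarith [Real.sin_sq_add_cos_sq (θ / 2)]
  have hnorm : (r * Real.cos θ - 1) * (r * Real.cos θ - 1) + r * Real.sin θ * (r * Real.sin θ) =
      r ^ 2 - 2 * r * Real.cos θ + 1 := by
    linear_combination r ^ 2 * Real.sin_sq_add_cos_sq θ
  rw [hnorm]
  nlinarith [mul_nonneg (sub_nonneg.2 hr) (sub_nonneg.2 (Real.cos_le_one θ)), sq_nonneg (r - 1)]

/-- An integrable majorant of `θ ↦ |r e^{iθ} - 1| ^ (-α)`, uniform in `r ≥ 1`. -/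
theorem norm_circleMap_sub_one_rpow_neg_le {r : ℝ} (hr : 1 ≤ r) {α : ℝ} (hα : 0 ≤ α) {θ : ℝ}
    (h0 : 0 < θ) (h1 : θ < 2 * Real.pi) :
    ‖circleMap 0 r (-θ) - 1‖ ^ (-α) ≤
      (θ / 2) ^ (-α) + ((2 * Real.pi - θ) / 2) ^ (-α) := by
  have hpi := Real.pi_pos
  have hjordan : ∀ x : ℝ, 0 ≤ x → x ≤ Real.pi → x / 2 ≤ 2 * Real.sin (x / 2) := by
    intro x hx hx'
    have h := Real.mul_le_sin (x := x / 2) (by linarith) (by linarith)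
    have h2 : 1 / 2 ≤ 2 / Real.pi := by
      rw [div_le_div_iff₀ two_pos hpi]
      linarith [Real.pi_le_four]
    nlinarith
  have hsymm : ‖circleMap 0 r (-θ) - 1‖ = ‖circleMap 0 r θ - 1‖ := by
    rw [← Complex.norm_conj (circleMap 0 r θ - 1)]
    simp [circleMap, ← Complex.exp_conj]
  have hper : circleMap 0 r (-θ) = circleMap 0 r (2 * Real.pi - θ) := by
    rw [← periodic_circleMap 0 r (-θ)]
    ring_nf
  have hp1 : 0 ≤ (θ / 2) ^ (-α) := by positivity
  have hp2 : 0 ≤ ((2 * Real.pi - θ) / 2) ^ (-α) := Real.rpow_nonneg (by linarith) _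
  rcases le_total θ Real.pi with h | h
  · have hle := (hjordan θ h0.le h).trans (two_mul_sin_half_le_norm_circleMap_sub_one hr θ)
    rw [hsymm]
    linarith [Real.rpow_le_rpow_of_nonpos (by linarith) hle (neg_nonpos.2 hα)]
  · have hle := (hjordan (2 * Real.pi - θ) (by linarith) (by linarith)).trans
      (two_mul_sin_half_le_norm_circleMap_sub_one hr _)
    rw [hper]
    linarith [Real.rpow_le_rpow_of_nonpos (by linarith) hle (neg_nonpos.2 hα)]

theorem intervalIntegrable_rpow_neg_add {α : ℝ} (hα : α < 1) :
    IntervalIntegrable (fun θ : ℝ => (θ / 2) ^ (-α) + ((2 * Real.pi - θ) / 2) ^ (-α))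
      MeasureTheory.volume 0 (2 * Real.pi) := by
  have h : IntervalIntegrable (fun θ : ℝ => (θ / 2) ^ (-α)) MeasureTheory.volume 0
      (2 * Real.pi) := by
    have := (intervalIntegral.intervalIntegrable_rpow' (a := 0) (b := Real.pi)
      (r := -α) (by linarith)).comp_mul_left (c := 1 / 2)
    convert this using 2 <;> ring_nf
  refine h.add ?_
  have := (h.comp_sub_left (2 * Real.pi)).symm
  simpa using this

/-- The resolvent bound of an `(α,β)`-RK operator on the circle of radius `1 + 1/n`, rewritten for
`(1 - zT)⁻¹` on the inverse circle. -/
theorem IsRK.norm_inverse_one_sub_smul_le {X : Type*} [NormedAddCommGroup X] [NormedSpace ℂ X]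
    {T : X →L[ℂ] X} {α β C : ℝ} (hα0 : 0 ≤ α) (hβ : 0 ≤ β) (hT : IsRK T α β C) {n : ℕ}
    (hn : 1 ≤ n) {θ : ℝ} (h0 : 0 < θ) (h1 : θ < 2 * Real.pi) :
    ‖Ring.inverse (1 - circleMap 0 (1 + 1 / (n : ℝ))⁻¹ θ • T)‖ ≤
      C * 2 ^ (α + β) * (n : ℝ) ^ β *
        ((θ / 2) ^ (-α) + ((2 * Real.pi - θ) / 2) ^ (-α)) := by
  have hn0 : (0 : ℝ) < n := by exact_mod_cast hn
  have hn1 : (1 : ℝ) ≤ n := by exact_mod_cast hn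
  have hC : 0 ≤ C := zero_le_one.trans hT.1
  set r : ℝ := 1 + 1 / (n : ℝ) with hr
  have hr1 : 1 < r := by
    have : 0 < 1 / (n : ℝ) := by positivity
    linarith
  have hr2 : r ≤ 2 := by
    have : 1 / (n : ℝ) ≤ 1 := by rw [div_le_one hn0]; exact hn1
    linarith
  have hr0 : 0 < r := by linarith
  set z : ℂ := circleMap 0 r (-θ) with hz
  have hzn : ‖z‖ = r := by simp [hz, abs_of_pos hr0]
  have hz0 : z ≠ 0 := by rw [← norm_pos_iff, hzn]; exact hr0
  have hzinv : circleMap 0 r⁻¹ θ = z⁻¹ := by rw [hz, circleMap_zero_inv, neg_neg]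
  obtain ⟨hu, hb⟩ := hT.2 z (hzn.symm ▸ hr1)
  rw [hzinv, inverse_one_sub_inv_smul hz0 hu, norm_smul, hzn]
  rw [hzn, show r - 1 = (n : ℝ)⁻¹ by rw [hr]; ring, Real.inv_rpow hn0.le] at hb
  have hmaj := norm_circleMap_sub_one_rpow_neg_le hr1.le hα0 h0 h1
  rw [← hz] at hmaj
  calc r * ‖Ring.inverse (algebraMap ℂ (X →L[ℂ] X) z - T)‖
      ≤ r * (C * r ^ (α + β - 1) / (‖z - 1‖ ^ α * ((n : ℝ) ^ β)⁻¹)) := by gcongr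
    _ = C * r ^ (α + β) * (n : ℝ) ^ β * ‖z - 1‖ ^ (-α) := by
        rw [Real.rpow_sub_one hr0.ne', Real.rpow_neg (norm_nonneg _), div_eq_mul_inv _ (_ * _),
          mul_inv, inv_inv]
        field_simp
    _ ≤ _ := by gcongr

/-- For an `(α,β)`-RK operator with `0 ≤ α < 1` and `β ≥ 1`, `‖T^n‖ = O(n^β)`. -/
theorem power_norm_O_nbeta
    {X : Type*} [NormedAddCommGroup X] [NormedSpace ℂ X] [CompleteSpace X]
    (T : X →L[ℂ] X) (α β C : ℝ) (hα0 : 0 ≤ α) (hα1 : α < 1) (hβ : 1 ≤ β)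
    (hT : IsRK T α β C) :
    ∃ M > (0 : ℝ), ∀ n : ℕ, 1 ≤ n → ‖T ^ n‖ ≤ M * (n : ℝ) ^ β := by
  have hn_base : ∀ n : ℕ, 1 ≤ n → (1 : ℝ) < 1 + 1 / (n : ℝ) := by
    intro n hn
    have hn0 : (0 : ℝ) < n := by exact_mod_cast hn
    linarith [one_div_pos.2 hn0]
  set g : ℝ → ℝ := fun θ => (θ / 2) ^ (-α) + ((2 * Real.pi - θ) / 2) ^ (-α) with hg
  have hpi : (0 : ℝ) ≤ 2 * Real.pi := Real.two_pi_pos.le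
  have hgi : IntervalIntegrable g MeasureTheory.volume 0 (2 * Real.pi) :=
    intervalIntegrable_rpow_neg_add hα1
  have hC : 0 ≤ C := zero_le_one.trans hT.1
  have hG : 0 ≤ ∫ θ in (0 : ℝ)..2 * Real.pi, g θ := by
    refine intervalIntegral.integral_nonneg hpi fun θ hθ => ?_
    exact add_nonneg (Real.rpow_nonneg (by linarith [hθ.1]) _)
      (Real.rpow_nonneg (by linarith [hθ.2]) _)
  set G : ℝ := ∫ θ in (0 : ℝ)..2 * Real.pi, g θ
  refine ⟨(2 * Real.pi)⁻¹ * (C * 2 ^ (α + β) * G) * Real.exp 1 + 1, by positivity, ?_⟩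
  intro n hn
  have hn0 : (0 : ℝ) < n := by exact_mod_cast hn
  have hr1 := hn_base n hn
  have hcauchy := norm_pow_le_integral_norm_inverse_one_sub_smul T
    (R := (1 + 1 / (n : ℝ))⁻¹) (by positivity) (fun w hw => by
      rcases eq_or_ne w 0 with rfl | hw0
      · simp
      have hlt : 1 < ‖w⁻¹‖ := by
        rw [norm_inv]
        exact hr1.trans_le ((le_inv_comm₀ (norm_pos_iff.2 hw0) (by linarith)).1 hw)
      simpa using isUnit_one_sub_inv_smul (inv_ne_zero hw0) (hT.2 _ hlt).1) n
  have hint : ∫ θ in (0 : ℝ)..2 * Real.pi,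
      ‖Ring.inverse (1 - circleMap 0 (1 + 1 / (n : ℝ))⁻¹ θ • T)‖ ≤
        C * 2 ^ (α + β) * (n : ℝ) ^ β * G := by
    rw [← intervalIntegral.integral_const_mul, intervalIntegral.integral_of_le hpi,
      intervalIntegral.integral_of_le hpi, MeasureTheory.integral_Ioc_eq_integral_Ioo,
      MeasureTheory.integral_Ioc_eq_integral_Ioo]
    refine MeasureTheory.integral_mono_of_nonneg
      (Filter.Eventually.of_forall fun θ => norm_nonneg _) ?_ ?_
    · exact (((intervalIntegrable_iff_integrableOn_Ioo_of_le hpi).1 hgi).const_mul _)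
    · filter_upwards [MeasureTheory.ae_restrict_mem measurableSet_Ioo] with θ hθ
      exact hT.norm_inverse_one_sub_smul_le hα0 (by linarith) hn hθ.1 hθ.2
  have hexp : (1 + 1 / (n : ℝ)) ^ n ≤ Real.exp 1 := by
    calc (1 + 1 / (n : ℝ)) ^ n ≤ Real.exp (1 / n) ^ n := by
          gcongr
          linarith [Real.add_one_le_exp (1 / (n : ℝ))]
      _ = Real.exp 1 := by
          rw [← Real.exp_nat_mul]
          congr 1
          field_simp
  calc ‖T ^ n‖ ≤ _ := hcauchy
    _ ≤ ((2 * Real.pi)⁻¹ * (C * 2 ^ (α + β) * (n : ℝ) ^ β * G)) * Real.exp 1 := by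
        rw [inv_inv]
        gcongr
    _ = ((2 * Real.pi)⁻¹ * (C * 2 ^ (α + β) * G) * Real.exp 1) * (n : ℝ) ^ β := by ring
    _ ≤ _ := by gcongr; linarith
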